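/- Assume ∑_{i=1}^N ωᵢ M θ_{i3}/δᵢ > 1 and let b > 0 satisfy F(b) = 0. With Cᵢ = (M θ_{i3}/δᵢ)[(θ_{i1}+θ_{i3}) e^{θ_{i1} b} + (θ_{i2}−θ_{i3}) e^{−θ_{i2} b}]^{−1} and dᵢ = (M/δᵢ) e^{θ_{i3} b}(θ_{i1} e^{θ_{i1} b} + θ_{i2} e^{−θ_{i2} b})/[(θ_{i1}+θ_{i3}) e^{θ_{i1} b} + (θ_{i2}−θ_{i3}) e^{−θ_{i2} b}], the second derivatives of the two pieces of the equilibrium value function match at b and the function is concave on [0,b]: ∑_{i=1}^N ωᵢ Cᵢ (θ_{i1}² e^{θ_{i1} b} − θ_{i2}² e^{−θ_{i2} b}) = −∑_{i=1}^N ωᵢ dᵢ θ_{i3}² e^{−θ_{i3} b}, and ∑_{i=1}^N ωᵢ Cᵢ (θ_{i1}² e^{θ_{i1} x} − θ_{i2}² e^{−θ_{i2} x}) < 0 for every x ∈ [0,b]. -/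

import Mathlib

open Real Finset

lemma root_aux (s η c y : ℝ) (hs : 0 < s) (hc : 0 < c)
    (hy : y = (η + Real.sqrt (η ^ 2 + 2 * s ^ 2 * c)) / s ^ 2) :
    0 < y ∧ s ^ 2 * y ^ 2 = 2 * η * y + 2 * c := by
  have h0 : 0 < 2 * s ^ 2 * c := by positivity
  have h1 : |η| < Real.sqrt (η ^ 2 + 2 * s ^ 2 * c) := by
    rw [← Real.sqrt_sq_eq_abs]
    exact Real.sqrt_lt_sqrt (sq_nonneg _) (by linarith)
  have h2 := Real.sq_sqrt (show 0 ≤ η ^ 2 + 2 * s ^ 2 * c by positivity)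
  have h3 := neg_abs_le η
  refine ⟨by rw [hy]; exact div_pos (by linarith) (by positivity), ?_⟩
  have h4 : s ^ 2 * y = η + Real.sqrt (η ^ 2 + 2 * s ^ 2 * c) := by
    rw [hy]; field_simp
  have h5 : s ^ 2 * y - η = Real.sqrt (η ^ 2 + 2 * s ^ 2 * c) := by linarith
  rw [← h5] at h2
  have h6 : s ^ 2 * (s ^ 2 * y ^ 2) = s ^ 2 * (2 * η * y + 2 * c) := by linarith
  exact mul_left_cancel₀ (by positivity) h6

theorem mixture_second_derivative_match_and_concavity
    (σ μ M : ℝ) (hσ : 0 < σ) (hμ : 0 < μ) (hM : 0 < M)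
    (N : ℕ) (hN : 1 ≤ N) (δ ω θ1 θ2 θ3 : Fin N → ℝ)
    (hδ : ∀ i, 0 < δ i) (hω : ∀ i, 0 < ω i) (hωsum : ∑ i, ω i = 1)
    (hθ1 : ∀ i, θ1 i = (-μ + Real.sqrt (μ ^ 2 + 2 * σ ^ 2 * δ i)) / σ ^ 2)
    (hθ2 : ∀ i, θ2 i = (μ + Real.sqrt (μ ^ 2 + 2 * σ ^ 2 * δ i)) / σ ^ 2)
    (hθ3 : ∀ i, θ3 i = ((μ - M) + Real.sqrt ((μ - M) ^ 2 + 2 * σ ^ 2 * δ i)) / σ ^ 2)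
    (F : ℝ → ℝ)
    (hF : ∀ b, F b = (∑ i, ω i * (M * θ3 i / δ i) *
        (θ1 i * Real.exp (θ1 i * b) + θ2 i * Real.exp (-θ2 i * b)) /
        ((θ1 i + θ3 i) * Real.exp (θ1 i * b) + (θ2 i - θ3 i) * Real.exp (-θ2 i * b))) - 1)
    (hcond : 1 < ∑ i, ω i * (M * θ3 i / δ i))
    (b : ℝ) (hb : 0 < b) (hFb : F b = 0)
    (C d : Fin N → ℝ)
    (hC : ∀ i, C i = (M * θ3 i / δ i) *
        ((θ1 i + θ3 i) * Real.exp (θ1 i * b) + (θ2 i - θ3 i) * Real.exp (-θ2 i * b))⁻¹)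
    (hd : ∀ i, d i = (M / δ i) * Real.exp (θ3 i * b) *
        (θ1 i * Real.exp (θ1 i * b) + θ2 i * Real.exp (-θ2 i * b)) /
        ((θ1 i + θ3 i) * Real.exp (θ1 i * b) + (θ2 i - θ3 i) * Real.exp (-θ2 i * b)))
 :
    (∑ i, ω i * C i * ((θ1 i) ^ 2 * Real.exp (θ1 i * b) - (θ2 i) ^ 2 * Real.exp (-θ2 i * b))
      = -∑ i, ω i * d i * (θ3 i) ^ 2 * Real.exp (-θ3 i * b)) ∧
    (∀ x ∈ Set.Icc (0 : ℝ) b,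
      ∑ i, ω i * C i * ((θ1 i) ^ 2 * Real.exp (θ1 i * x) - (θ2 i) ^ 2 * Real.exp (-θ2 i * x))
        < 0) := by
  have r1 := fun i => root_aux σ (-μ) (δ i) (θ1 i) hσ (hδ i) (by rw [hθ1 i, neg_sq])
  have r2 := fun i => root_aux σ μ (δ i) (θ2 i) hσ (hδ i) (hθ2 i)
  have r3 := fun i => root_aux σ (μ - M) (δ i) (θ3 i) hσ (hδ i) (hθ3 i)
  have hD : ∀ i, 0 < (θ1 i + θ3 i) * Real.exp (θ1 i * b)
      + (θ2 i - θ3 i) * Real.exp (-θ2 i * b) := by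
    intro i
    have p1 := (r1 i).1
    have p2 := (r2 i).1
    have p3 := (r3 i).1
    have hle : Real.exp (-θ2 i * b) ≤ Real.exp (θ1 i * b) := by
      apply Real.exp_le_exp.2
      nlinarith [mul_pos p1 hb, mul_pos p2 hb]
    have e2 := Real.exp_pos (-θ2 i * b)
    nlinarith [mul_nonneg (add_pos p1 p3).le (sub_nonneg.2 hle), mul_pos (add_pos p1 p2) e2]
  have hCpos : ∀ i, 0 < C i := by
    intro i
    rw [hC i]
    have := hD i
    have := (r3 i).1
    have := hδ i
    positivity
  have hdpos : ∀ i, 0 < d i := by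
    intro i
    rw [hd i]
    have := hD i
    have := (r1 i).1
    have := (r2 i).1
    have := hδ i
    positivity
  have key : ∀ i, ω i * C i * ((θ1 i) ^ 2 * Real.exp (θ1 i * b)
        - (θ2 i) ^ 2 * Real.exp (-θ2 i * b))
      = -(ω i * d i * (θ3 i) ^ 2 * Real.exp (-θ3 i * b))
        + 2 * M / σ ^ 2 * (ω i - ω i * (M * θ3 i / δ i) *
        (θ1 i * Real.exp (θ1 i * b) + θ2 i * Real.exp (-θ2 i * b)) /
        ((θ1 i + θ3 i) * Real.exp (θ1 i * b) + (θ2 i - θ3 i) * Real.exp (-θ2 i * b))) := by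
    intro i
    have hE : Real.exp (-θ3 i * b) = (Real.exp (θ3 i * b))⁻¹ := by
      rw [← Real.exp_neg, neg_mul]
    rw [hC i, hd i, hE]
    have hDi := (hD i).ne'
    have q1 := (r1 i).2
    have q2 := (r2 i).2
    have q3 := (r3 i).2
    have hδi := (hδ i).ne'
    have hX := (Real.exp_pos (θ3 i * b)).ne'
    generalize Real.exp (θ3 i * b) = X at *
    generalize Real.exp (θ1 i * b) = E1 at *
    generalize Real.exp (-θ2 i * b) = E2 at *
    generalize hDD : (θ1 i + θ3 i) * E1 + (θ2 i - θ3 i) * E2 = D at *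
    have hmain : σ ^ 2 * (θ3 i * (θ1 i ^ 2 * E1 - θ2 i ^ 2 * E2))
        = - (σ ^ 2 * (θ3 i ^ 2 * (θ1 i * E1 + θ2 i * E2)))
          + 2 * (δ i * D - M * θ3 i * (θ1 i * E1 + θ2 i * E2)) := by
      rw [← hDD]
      linear_combination θ3 i * E1 * q1 - θ3 i * E2 * q2 + (θ1 i * E1 + θ2 i * E2) * q3
    have l : ω i * (M * θ3 i / δ i * D⁻¹) * (θ1 i ^ 2 * E1 - θ2 i ^ 2 * E2)
        = ω i * M / (δ i * D * σ ^ 2) * (σ ^ 2 * (θ3 i * (θ1 i ^ 2 * E1 - θ2 i ^ 2 * E2))) := by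
      field_simp
    rw [l, hmain]
    field_simp
    try ring
  have hsum : ∑ i, ω i * C i * ((θ1 i) ^ 2 * Real.exp (θ1 i * b)
        - (θ2 i) ^ 2 * Real.exp (-θ2 i * b))
      = -∑ i, ω i * d i * (θ3 i) ^ 2 * Real.exp (-θ3 i * b) := by
    rw [hF b] at hFb
    rw [Finset.sum_congr rfl (fun i _ => key i), Finset.sum_add_distrib, ← Finset.mul_sum,
      Finset.sum_sub_distrib, Finset.sum_neg_distrib, hωsum]
    have h1 := sub_eq_zero.1 hFb
    rw [h1]
    ring
  refine ⟨hsum, fun x hx => ?_⟩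
  have hneg : 0 < ∑ i, ω i * d i * (θ3 i) ^ 2 * Real.exp (-θ3 i * b) := by
    apply Finset.sum_pos
    · intro i _
      have := hω i
      have := hdpos i
      have := (r3 i).1
      positivity
    · exact ⟨⟨0, hN⟩, Finset.mem_univ _⟩
  refine lt_of_le_of_lt (b := -∑ i, ω i * d i * (θ3 i) ^ 2 * Real.exp (-θ3 i * b)) ?_
    (by linarith)
  rw [← hsum]
  apply Finset.sum_le_sum
  intro i _
  apply mul_le_mul_of_nonneg_left _ (mul_pos (hω i) (hCpos i)).le
  have a1 : Real.exp (θ1 i * x) ≤ Real.exp (θ1 i * b) :=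
    Real.exp_le_exp.2 (mul_le_mul_of_nonneg_left hx.2 (r1 i).1.le)
  have a2 : Real.exp (-θ2 i * b) ≤ Real.exp (-θ2 i * x) :=
    Real.exp_le_exp.2 (mul_le_mul_of_nonpos_left hx.2 (by linarith [(r2 i).1]))
  exact sub_le_sub (mul_le_mul_of_nonneg_left a1 (sq_nonneg _))
    (mul_le_mul_of_nonneg_left a2 (sq_nonneg _))
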